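/- For all integers m ≥ 1, n ≥ 0 and q ≥ 2m+n: Σ_{p=2m+n}^{q} (−1)^p · (2q−p)! / (p!·(q−p)!·(p−2m−n)!) · (2n−p+2m+2)_{2p−4m−2n} = (−1)^n · (2^{2q−4m−2n}/(m−1)!) · (q−2m−n+1)_{m−1} · (m+n+3/2)_{q−2m−n}. -/

import Mathlib

open Finset

/-- The Pochhammer symbol `(f)_n = f (f+1) ⋯ (f+n-1)`, with `(f)_0 = 1`. -/
noncomputable def poch (f : ℝ) (n : ℕ) : ℝ := ∏ i ∈ Finset.range n, (f + (i : ℝ))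

lemma poch_succ_right (f : ℝ) (n : ℕ) : poch f (n + 1) = poch f n * (f + n) := by
  simp [poch, Finset.prod_range_succ]

lemma poch_succ_left (f : ℝ) (n : ℕ) : poch f (n + 1) = f * poch (f + 1) n := by
  unfold poch
  rw [Finset.prod_range_succ', mul_comm]
  congr 1
  · simp
  · apply Finset.prod_congr rfl
    intro i _
    push_cast
    ring

lemma poch_step (x : ℝ) (j : ℕ) :
    poch (x - (j + 1 : ℕ)) (2 * (j + 1)) = (x - 1 - j) * poch (x - j) (2 * j) * (x + j) := by
  rw [show 2 * (j + 1) = (2 * j + 1) + 1 by ring, poch_succ_left, poch_succ_right]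
  push_cast
  rw [show x - (j + 1) + 1 = x - (j : ℝ) by ring]
  ring

/-- The summand after shifting. -/
noncomputable def sF (m n Q j : ℕ) : ℝ :=
  (-1 : ℝ) ^ j * ((2 * Q + 2 * m + n - j).factorial : ℝ) /
    (((2 * m + n + j).factorial : ℝ) * ((Q - j).factorial : ℝ) * (j.factorial : ℝ)) *
      poch ((n : ℝ) + 2 - j) (2 * j)

/-- The telescoping certificate. -/
noncomputable def sG (m n Q j : ℕ) : ℝ :=
  -(j : ℝ) * (2 * m + n + j) * ((-1 : ℝ) ^ j * ((2 * Q + 2 * m + n + 1 - j).factorial : ℝ) /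
    (((2 * m + n + j).factorial : ℝ) * ((Q + 1 - j).factorial : ℝ) * (j.factorial : ℝ))) *
      poch ((n : ℝ) + 2 - j) (2 * j)

lemma sG_step (m n Q j : ℕ) (h : j ≤ Q) :
    sG m n Q (j + 1) - sG m n Q j =
      ((Q : ℝ) + 1) * sF m n (Q + 1) j
        - ((Q : ℝ) + m) * (4 * Q + 4 * m + 4 * n + 6) * sF m n Q j := by
  obtain ⟨d, rfl⟩ := Nat.exists_eq_add_of_le h
  unfold sG sF
  rw [poch_step]
  rw [show 2 * (j + d) + 2 * m + n + 1 - (j + 1) = j + 2 * d + 2 * m + n by omega,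
    show 2 * (j + d) + 2 * m + n + 1 - j = (j + 2 * d + 2 * m + n) + 1 by omega,
    show 2 * (j + d + 1) + 2 * m + n - j = (j + 2 * d + 2 * m + n) + 1 + 1 by omega,
    show 2 * (j + d) + 2 * m + n - j = (j + 2 * d + 2 * m + n) by omega,
    show j + d + 1 - (j + 1) = d by omega,
    show j + d + 1 - j = d + 1 by omega,
    show j + d - j = d by omega,
    show 2 * m + n + (j + 1) = (2 * m + n + j) + 1 by omega]
  simp only [Nat.factorial_succ]
  have h1 : ((2 * m + n + j).factorial : ℝ) ≠ 0 := by positivity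
  have h2 : (d.factorial : ℝ) ≠ 0 := by positivity
  have h3 : (j.factorial : ℝ) ≠ 0 := by positivity
  generalize ((j + 2 * d + 2 * m + n).factorial) = A
  generalize ((2 * m + n + j).factorial) = B at *
  generalize poch ((n : ℝ) + 2 - j) (2 * j) = P
  have h4 : (2 * (m : ℝ) + n + j + 1) ≠ 0 := by positivity
  have h5 : ((d : ℝ) + 1) ≠ 0 := by positivity
  have h6 : ((j : ℝ) + 1) ≠ 0 := by positivity
  push_cast
  rw [pow_succ]
  field_simp
  ring

lemma sum_eq_sG (m n Q k : ℕ) (h : k ≤ Q + 1) :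
    ∑ j ∈ Finset.range k, (((Q : ℝ) + 1) * sF m n (Q + 1) j
        - ((Q : ℝ) + m) * (4 * Q + 4 * m + 4 * n + 6) * sF m n Q j) = sG m n Q k := by
  induction k with
  | zero => simp [sG]
  | succ k ih =>
    rw [Finset.sum_range_succ, ih (by omega), ← sG_step m n Q k (by omega)]
    ring

lemma last_term (m n Q : ℕ) :
    sG m n Q (Q + 1) + ((Q : ℝ) + 1) * sF m n (Q + 1) (Q + 1) = 0 := by
  unfold sG sF
  rw [show 2 * Q + 2 * m + n + 1 - (Q + 1) = 2 * m + n + Q by omega,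
    show 2 * (Q + 1) + 2 * m + n - (Q + 1) = (2 * m + n + Q) + 1 by omega,
    show 2 * m + n + (Q + 1) = (2 * m + n + Q) + 1 by omega]
  simp only [Nat.factorial_succ]
  push_cast
  ring

lemma sum_rec (m n Q : ℕ) :
    ((Q : ℝ) + 1) * ∑ j ∈ Finset.range (Q + 1 + 1), sF m n (Q + 1) j =
      ((Q : ℝ) + m) * (4 * Q + 4 * m + 4 * n + 6) * ∑ j ∈ Finset.range (Q + 1), sF m n Q j := by
  have h := sum_eq_sG m n Q (Q + 1) le_rfl
  rw [Finset.sum_sub_distrib, ← Finset.mul_sum, ← Finset.mul_sum] at h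
  rw [Finset.sum_range_succ]
  linarith [last_term m n Q]

lemma poch_one (k : ℕ) : poch 1 k = k.factorial := by
  induction k with
  | zero => simp [poch]
  | succ k ih =>
    rw [poch_succ_right, ih, Nat.factorial_succ]
    push_cast
    ring

lemma sum_eval (m n Q : ℕ) :
    ∑ j ∈ Finset.range (Q + 1), sF (m + 1) n Q j =
      4 ^ Q / (m.factorial : ℝ) * poch ((Q : ℝ) + 1) m
        * poch ((m : ℝ) + 1 + n + 3 / 2) Q := by
  induction Q with
  | zero =>
    have h1 : ((2 * (m + 1) + n).factorial : ℝ) ≠ 0 := by positivity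
    have h2 : (m.factorial : ℝ) ≠ 0 := by positivity
    simp [sF, poch_one, h2]
    simp [poch, h1]
  | succ Q ih =>
    have h := sum_rec (m + 1) n Q
    rw [ih] at h
    have hQ : ((Q : ℝ) + 1) ≠ 0 := by positivity
    apply mul_left_cancel₀ hQ
    rw [h, poch_succ_right]
    have e : ((Q : ℝ) + 1) * poch ((Q : ℝ) + 1 + 1) m
        = poch ((Q : ℝ) + 1) m * ((Q : ℝ) + 1 + m) := by
      rw [← poch_succ_left, poch_succ_right]
    push_cast
    calc _ = 4 ^ (Q + 1) / (m.factorial : ℝ) * (poch ((Q : ℝ) + 1) m * ((Q : ℝ) + 1 + m)) *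
          (poch ((m : ℝ) + 1 + n + 3 / 2) Q * ((m : ℝ) + 1 + n + 3 / 2 + Q)) := by ring
      _ = _ := by rw [← e]; ring

/-- Evaluation of a terminating `₃F₂(1)` sum. -/
theorem terminating_3F2_evaluation (m n q : ℕ) (hm : 1 ≤ m) (hq : 2 * m + n ≤ q) :
    ∑ p ∈ Finset.Icc (2 * m + n) q,
        (-1 : ℝ) ^ p * ((2 * q - p).factorial : ℝ) /
            ((p.factorial : ℝ) * ((q - p).factorial : ℝ) * ((p - 2 * m - n).factorial : ℝ)) *
          poch (2 * (n : ℝ) - p + 2 * m + 2) (2 * p - 4 * m - 2 * n) =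
      (-1 : ℝ) ^ n * 2 ^ (2 * q - 4 * m - 2 * n) / ((m - 1).factorial : ℝ) *
        poch ((q : ℝ) - 2 * m - n + 1) (m - 1) * poch ((m : ℝ) + n + 3 / 2) (q - 2 * m - n) := by
  obtain ⟨Q, rfl⟩ := Nat.exists_eq_add_of_le hq
  obtain ⟨m, rfl⟩ := Nat.exists_eq_add_of_le' hm
  have h := sum_eval m n Q
  rw [← Finset.Ico_add_one_right_eq_Icc, Finset.sum_Ico_eq_sum_range,
    show 2 * (m + 1) + n + Q + 1 - (2 * (m + 1) + n) = Q + 1 by omega]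
  have h' : ∀ j ∈ Finset.range (Q + 1), (-1 : ℝ) ^ (2 * (m + 1) + n + j) *
      ((2 * (2 * (m + 1) + n + Q) - (2 * (m + 1) + n + j)).factorial : ℝ) /
            (((2 * (m + 1) + n + j).factorial : ℝ) *
              ((2 * (m + 1) + n + Q - (2 * (m + 1) + n + j)).factorial : ℝ) *
              ((2 * (m + 1) + n + j - 2 * (m + 1) - n).factorial : ℝ)) *
          poch (2 * (n : ℝ) - (2 * (m + 1) + n + j : ℕ) + 2 * (m + 1 : ℕ) + 2)
            (2 * (2 * (m + 1) + n + j) - 4 * (m + 1) - 2 * n) =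
      (-1 : ℝ) ^ n * sF (m + 1) n Q j := by
    intro j hj
    have hj' : j ≤ Q := by simp at hj; omega
    unfold sF
    rw [show 2 * (2 * (m + 1) + n + Q) - (2 * (m + 1) + n + j)
        = 2 * Q + 2 * (m + 1) + n - j by omega,
      show 2 * (m + 1) + n + Q - (2 * (m + 1) + n + j) = Q - j by omega,
      show 2 * (m + 1) + n + j - 2 * (m + 1) - n = j by omega,
      show 2 * (2 * (m + 1) + n + j) - 4 * (m + 1) - 2 * n = 2 * j by omega,
      show (2 * (n : ℝ) - (2 * (m + 1) + n + j : ℕ) + 2 * (m + 1 : ℕ) + 2)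
        = (n : ℝ) + 2 - j by push_cast; ring,
      pow_add, pow_add, pow_mul]
    simp only [even_two, Even.neg_pow, one_pow, one_mul]
    ring
  rw [Finset.sum_congr rfl h', ← Finset.mul_sum, h,
    show 2 * (2 * (m + 1) + n + Q) - 4 * (m + 1) - 2 * n = 2 * Q by omega,
    show 2 * (m + 1) + n + Q - 2 * (m + 1) - n = Q by omega,
    show m + 1 - 1 = m by omega, pow_mul,
    show (((2 * (m + 1) + n + Q : ℕ) : ℝ) - 2 * (m + 1 : ℕ) - n + 1) = (Q : ℝ) + 1 by
      push_cast; ring]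
  push_cast
  norm_num
  ring
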